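/- arXiv:2010.03469 — 2 statements merged into one kernel-verified Lean document; each statement's English description precedes it below -/
import Mathlib

section
/- Let β > 0 and let S_β = {z ∈ ℂ : 0 < Im z < β} be the open horizontal strip, with closure S̄_β = {z : 0 ≤ Im z ≤ β} and boundary ∂S_β = {z : Im z = 0 or Im z = β}. Let (Fₙ) be a sequence of functions ℂ → ℂ such that each Fₙ is continuous and bounded on S̄_β and complex differentiable on S_β, and suppose (Fₙ) is uniformly Cauchy on ∂S_β. Then (Fₙ) converges uniformly on S̄_β to a function F that is continuous and bounded on S̄_β and complex differentiable on S_β. -/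
open Filter

/-- **Three lines maximum principle**: a function continuous and bounded on a closed horizontal
strip and holomorphic inside it is bounded by any bound for it on the boundary lines. -/
theorem norm_le_of_norm_le_boundary_strip {β : ℝ} (hβ : 0 < β) {f : ℂ → ℂ} {C : ℝ}
    (hcont : ContinuousOn f {z : ℂ | 0 ≤ z.im ∧ z.im ≤ β})
    (hbd : ∃ B : ℝ, ∀ z ∈ {z : ℂ | 0 ≤ z.im ∧ z.im ≤ β}, ‖f z‖ ≤ B)
    (hdiff : DifferentiableOn ℂ f {z : ℂ | 0 < z.im ∧ z.im < β})
    (hC : ∀ z ∈ {z : ℂ | z.im = 0 ∨ z.im = β}, ‖f z‖ ≤ C)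
    {z : ℂ} (hz : z ∈ {z : ℂ | 0 ≤ z.im ∧ z.im ≤ β}) : ‖f z‖ ≤ C := by
  obtain ⟨B, hB⟩ := hbd
  have hcl : IsClosed {z : ℂ | 0 ≤ z.im ∧ z.im ≤ β} :=
    (isClosed_le continuous_const Complex.continuous_im).inter
      (isClosed_le Complex.continuous_im continuous_const)
  refine PhragmenLindelof.horizontal_strip (a := 0) (b := β)
    ⟨hdiff, hcont.mono (closure_minimal (fun w hw ↦ ⟨hw.1.le, hw.2.le⟩) hcl)⟩
    ⟨0, by rw [sub_zero]; positivity, 0, Asymptotics.IsBigO.of_bound B ?_⟩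
    (fun w hw ↦ hC w (Or.inl hw)) (fun w hw ↦ hC w (Or.inr hw)) hz.1 hz.2
  filter_upwards [mem_inf_of_right (mem_principal_self _)] with w hw
  simpa using hB w ⟨hw.1.le, hw.2.le⟩

/-- a sequence of functions, each continuous and bounded on the closed strip
`0 ≤ Im z ≤ β` and holomorphic on the open strip `0 < Im z < β`, which is uniformly Cauchy
on the boundary `Im z ∈ {0, β}`, converges uniformly on the closed strip to a function
continuous and bounded on the closed strip and holomorphic on the open strip. -/
theorem stmt9 (β : ℝ) (hβ : 0 < β) (F : ℕ → ℂ → ℂ)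
    (hcont : ∀ n, ContinuousOn (F n) {z : ℂ | 0 ≤ z.im ∧ z.im ≤ β})
    (hbd : ∀ n, ∃ C : ℝ, ∀ z ∈ {z : ℂ | 0 ≤ z.im ∧ z.im ≤ β}, ‖F n z‖ ≤ C)
    (hdiff : ∀ n, DifferentiableOn ℂ (F n) {z : ℂ | 0 < z.im ∧ z.im < β})
    (hcauchy : UniformCauchySeqOn F atTop {z : ℂ | z.im = 0 ∨ z.im = β}) :
    ∃ G : ℂ → ℂ,
      TendstoUniformlyOn F G atTop {z : ℂ | 0 ≤ z.im ∧ z.im ≤ β} ∧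
      ContinuousOn G {z : ℂ | 0 ≤ z.im ∧ z.im ≤ β} ∧
      (∃ C : ℝ, ∀ z ∈ {z : ℂ | 0 ≤ z.im ∧ z.im ≤ β}, ‖G z‖ ≤ C) ∧
      DifferentiableOn ℂ G {z : ℂ | 0 < z.im ∧ z.im < β} := by
  have hcau : UniformCauchySeqOn F atTop {z : ℂ | 0 ≤ z.im ∧ z.im ≤ β} := by
    rw [Metric.uniformCauchySeqOn_iff] at hcauchy ⊢
    intro ε hε
    obtain ⟨N, hN⟩ := hcauchy (ε / 2) (half_pos hε)
    refine ⟨N, fun m hm n hn z hz ↦ ?_⟩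
    rw [dist_eq_norm]
    refine lt_of_le_of_lt ?_ (half_lt_self hε)
    obtain ⟨Bm, hBm⟩ := hbd m
    obtain ⟨Bn, hBn⟩ := hbd n
    refine norm_le_of_norm_le_boundary_strip hβ (f := fun w ↦ F m w - F n w)
      ((hcont m).sub (hcont n))
      ⟨Bm + Bn, fun w hw ↦ (norm_sub_le _ _).trans (add_le_add (hBm w hw) (hBn w hw))⟩
      ((hdiff m).sub (hdiff n)) (fun w hw ↦ ?_) hz
    rw [← dist_eq_norm]
    exact (hN m hm n hn w hw).le
  have hlim : ∀ z : ℂ, ∃ w : ℂ, z ∈ {z : ℂ | 0 ≤ z.im ∧ z.im ≤ β} →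
      Tendsto (fun n ↦ F n z) atTop (nhds w) := fun z ↦ by
    by_cases hz : z ∈ {z : ℂ | 0 ≤ z.im ∧ z.im ≤ β}
    · obtain ⟨w, hw⟩ := cauchySeq_tendsto_of_complete (hcau.cauchySeq hz)
      exact ⟨w, fun _ ↦ hw⟩
    · exact ⟨0, fun h ↦ absurd h hz⟩
  choose G hG using hlim
  have hunif : TendstoUniformlyOn F G atTop {z : ℂ | 0 ≤ z.im ∧ z.im ≤ β} :=
    hcau.tendstoUniformlyOn_of_tendsto hG
  refine ⟨G, hunif, hunif.continuousOn (Frequently.of_forall hcont), ?_, ?_⟩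
  · obtain ⟨n, hn⟩ := (Metric.tendstoUniformlyOn_iff.mp hunif 1 one_pos).exists
    obtain ⟨B, hB⟩ := hbd n
    refine ⟨1 + B, fun z hz ↦ ?_⟩
    have h := hn z hz
    rw [dist_eq_norm] at h
    linarith [norm_le_norm_sub_add (G z) (F n z), hB z hz]
  · have hopen : IsOpen {z : ℂ | 0 < z.im ∧ z.im < β} :=
      (isOpen_lt continuous_const Complex.continuous_im).inter
        (isOpen_lt Complex.continuous_im continuous_const)
    exact (hunif.mono fun z hz ↦ ⟨hz.1.le, hz.2.le⟩).tendstoLocallyUniformlyOn.differentiableOn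
      (Eventually.of_forall hdiff) hopen
end

section
/- Let β > 0 and let S_β = {z ∈ ℂ : 0 < Im z < β} be the open horizontal strip, with closure S̄_β and boundary ∂S_β = {z : Im z ∈ {0, β}}. Let (Fₙ) be a sequence of functions ℂ × ℂ → ℂ such that each Fₙ is continuous and bounded on S̄_β × S̄_β and complex differentiable on S_β × S_β, and suppose (Fₙ) is uniformly Cauchy on ∂S_β × ∂S_β. Then (Fₙ) converges uniformly on S̄_β × S̄_β to a function F that is continuous and bounded on S̄_β × S̄_β and complex differentiable on S_β × S_β. -/
open Filter

open Topology Metric Set Complex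

/-- A uniform limit, on an open subset of a complex normed space, of a sequence of complex
differentiable functions is complex differentiable. -/
theorem TendstoUniformlyOn.differentiableOn_of_isOpen {E V : Type*}
    [NormedAddCommGroup E] [NormedSpace ℂ E] [NormedAddCommGroup V] [NormedSpace ℂ V]
    [CompleteSpace V] {F : ℕ → E → V} {G : E → V} {U : Set E} (hU : IsOpen U)
    (hF : ∀ n, DifferentiableOn ℂ (F n) U) (hFG : TendstoUniformlyOn F G atTop U) :
    DifferentiableOn ℂ G U := by
  intro x hx
  obtain ⟨r, hr, hrU⟩ := Metric.isOpen_iff.1 hU x hx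
  have hsub : ∀ y ∈ ball x (r / 2), ball y (r / 2) ⊆ U := fun y hy =>
    (ball_subset_ball' (by rw [mem_ball] at hy; linarith)).trans hrU
  have hyU : ∀ y ∈ ball x (r / 2), y ∈ U := fun y hy =>
    hsub y hy (mem_ball_self (by positivity))
  have hdAt : ∀ n, ∀ y ∈ ball x (r / 2), DifferentiableAt ℂ (F n) y := fun n y hy =>
    (hF n).differentiableAt (hU.mem_nhds (hyU y hy))
  have hcauchy : UniformCauchySeqOn (fun n y => fderiv ℂ (F n) y) atTop (ball x (r / 2)) := by
    rw [Metric.uniformCauchySeqOn_iff]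
    intro ε hε
    obtain ⟨N, hN⟩ := Metric.uniformCauchySeqOn_iff.1 hFG.uniformCauchySeqOn (ε * r / 8)
      (by positivity)
    refine ⟨N, fun m hm n hn y hy => ?_⟩
    have hmaps : MapsTo (F m - F n) (ball y (r / 2))
        (closedBall ((F m - F n) y) (ε * r / 4)) := by
      intro z hz
      have h1 := hN m hm n hn z (hsub y hy hz)
      have h2 := hN m hm n hn y (hyU y hy)
      rw [dist_eq_norm] at h1 h2
      rw [mem_closedBall, dist_eq_norm]
      refine (norm_sub_le _ _).trans ?_
      simp only [Pi.sub_apply]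
      linarith
    have hle := norm_fderiv_le_div_of_mapsTo_ball
      (((hF m).sub (hF n)).mono (hsub y hy)) hmaps (by positivity)
    rw [fderiv_sub (hdAt m y hy) (hdAt n y hy)] at hle
    rw [dist_eq_norm]
    refine hle.trans_lt ?_
    rw [div_lt_iff₀ (by positivity)]
    nlinarith [mul_pos hε hr]
  have hlim : ∀ y ∈ ball x (r / 2), ∃ L, Tendsto (fun n => fderiv ℂ (F n) y) atTop (𝓝 L) :=
    fun y hy => cauchySeq_tendsto_of_complete (hcauchy.cauchySeq hy)
  choose! L hL using hlim
  exact (hasFDerivAt_of_tendstoUniformlyOn isOpen_ball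
    (hcauchy.tendstoUniformlyOn_of_tendsto hL) (fun n y hy => (hdAt n y hy).hasFDerivAt)
    (fun y hy => hFG.tendsto_at (hyU y hy))
    (mem_ball_self (by positivity))).differentiableAt.differentiableWithinAt

/-- If `f` is continuous on `closure S ×ˢ closure T` and holomorphic on `S ×ˢ T`, then its slices
at points of `closure T` are holomorphic on `S`. -/
theorem diffContOnCl_slice {V : Type*} [NormedAddCommGroup V] [NormedSpace ℂ V] [CompleteSpace V]
    {f : ℂ × ℂ → V} {S T : Set ℂ} (hS : IsOpen S)
    (hf : ContinuousOn f (closure S ×ˢ closure T)) (hd : DifferentiableOn ℂ f (S ×ˢ T))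
    {w : ℂ} (hw : w ∈ closure T) : DiffContOnCl ℂ (fun z => f (z, w)) S := by
  refine ⟨?_, hf.comp (by fun_prop) fun z hz => ⟨hz, hw⟩⟩
  have : (𝓝[T] w).NeBot := mem_closure_iff_nhdsWithin_neBot.1 hw
  refine TendstoLocallyUniformlyOn.differentiableOn (φ := 𝓝[T] w) (F := fun v z => f (z, v))
    ?_ ?_ hS
  · rw [tendstoLocallyUniformlyOn_iff_forall_tendsto]
    intro z hz
    have hcl : z ∈ closure S := subset_closure hz
    have h1 : Tendsto (fun y : ℂ × ℂ => f (y.2, w)) (𝓝[T] w ×ˢ 𝓝[S] z) (𝓝 (f (z, w))) := by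
      refine (hf (z, w) ⟨hcl, hw⟩).tendsto.comp (tendsto_nhdsWithin_iff.2 ⟨?_, ?_⟩)
      · exact (tendsto_snd.mono_right nhdsWithin_le_nhds).prodMk_nhds tendsto_const_nhds
      · filter_upwards [tendsto_snd.eventually (self_mem_nhdsWithin (a := z) (s := S))] with y hy
        exact ⟨subset_closure hy, hw⟩
    have h2 : Tendsto (fun y : ℂ × ℂ => f (y.2, y.1)) (𝓝[T] w ×ˢ 𝓝[S] z) (𝓝 (f (z, w))) := by
      refine (hf (z, w) ⟨hcl, hw⟩).tendsto.comp (tendsto_nhdsWithin_iff.2 ⟨?_, ?_⟩)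
      · exact (tendsto_snd.mono_right nhdsWithin_le_nhds).prodMk_nhds
          (tendsto_fst.mono_right nhdsWithin_le_nhds)
      · filter_upwards [tendsto_snd.eventually (self_mem_nhdsWithin (a := z) (s := S)),
          tendsto_fst.eventually (self_mem_nhdsWithin (a := w) (s := T))] with y hy hy'
        exact ⟨subset_closure hy, subset_closure hy'⟩
    exact (h1.prodMk_nhds h2).mono_right (nhds_le_uniformity _)
  · filter_upwards [self_mem_nhdsWithin] with v hv
    exact hd.comp (by fun_prop) fun z hz => ⟨hz, hv⟩

/-- Maximum principle for bounded holomorphic functions on a horizontal strip. -/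
theorem norm_le_of_horizontal_strip {V : Type*} [NormedAddCommGroup V] [NormedSpace ℂ V]
    {a b : ℝ} {f : ℂ → V} (hab : a < b) (hf : DiffContOnCl ℂ f (im ⁻¹' Ioo a b))
    {M : ℝ} (hM : ∀ z ∈ im ⁻¹' Ioo a b, ‖f z‖ ≤ M) {C : ℝ}
    (hC : ∀ z : ℂ, z.im = a ∨ z.im = b → ‖f z‖ ≤ C) {z : ℂ} (hz : a ≤ z.im ∧ z.im ≤ b) :
    ‖f z‖ ≤ C := by
  refine PhragmenLindelof.horizontal_strip hf
    ⟨0, div_pos Real.pi_pos (sub_pos.2 hab), 0, ?_⟩ (fun z h => hC z (.inl h))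
    (fun z h => hC z (.inr h)) hz.1 hz.2
  refine Asymptotics.IsBigO.of_bound M (mem_inf_of_right fun z hz => ?_)
  simpa using hM z hz

/-- Maximum principle for bounded holomorphic functions on a product of two copies of a horizontal
strip: the norm is controlled by its values on the distinguished boundary. -/
theorem norm_le_of_prod_horizontal_strip {V : Type*} [NormedAddCommGroup V] [NormedSpace ℂ V]
    [CompleteSpace V] {a b : ℝ} {f : ℂ × ℂ → V} (hab : a < b)
    (hf : ContinuousOn f ((im ⁻¹' Icc a b) ×ˢ (im ⁻¹' Icc a b)))
    (hd : DifferentiableOn ℂ f ((im ⁻¹' Ioo a b) ×ˢ (im ⁻¹' Ioo a b)))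
    {M : ℝ} (hM : ∀ p ∈ (im ⁻¹' Icc a b) ×ˢ (im ⁻¹' Icc a b), ‖f p‖ ≤ M) {C : ℝ}
    (hC : ∀ z w : ℂ, (z.im = a ∨ z.im = b) → (w.im = a ∨ w.im = b) → ‖f (z, w)‖ ≤ C)
    {z w : ℂ} (hz : z ∈ im ⁻¹' Icc a b) (hw : w ∈ im ⁻¹' Icc a b) : ‖f (z, w)‖ ≤ C := by
  have hcl : closure (im ⁻¹' Ioo a b) = im ⁻¹' Icc a b := by
    rw [closure_preimage_im, closure_Ioo hab.ne]
  have hop : IsOpen (im ⁻¹' Ioo a b) := isOpen_Ioo.preimage continuous_im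
  have hsub : im ⁻¹' Ioo a b ⊆ im ⁻¹' Icc a b := preimage_mono Ioo_subset_Icc_self
  have hbdry : ∀ v : ℂ, v.im = a ∨ v.im = b → v ∈ im ⁻¹' Icc a b := by
    rintro v (h | h) <;> simp [h, hab.le]
  rw [← hcl] at hf
  refine norm_le_of_horizontal_strip (f := fun v => f (z, v)) hab
    (diffContOnCl_slice (f := f ∘ Prod.swap) hop
      (hf.comp (by fun_prop) fun p hp => ⟨hp.2, hp.1⟩)
      (hd.comp (differentiable_snd.prodMk differentiable_fst).differentiableOn
        fun p hp => ⟨hp.2, hp.1⟩) (hcl ▸ hz))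
    (fun v hv => hM _ ⟨hz, hsub hv⟩) (fun v hv => ?_) hw
  exact norm_le_of_horizontal_strip (f := fun u => f (u, v)) hab
    (diffContOnCl_slice hop hf hd (hcl ▸ hbdry v hv))
    (fun u hu => hM _ ⟨hsub hu, hbdry v hv⟩) (fun u hu => hC u v hu hv) hz

/-- a sequence of two-variable functions, each continuous and bounded on
`S̄_β × S̄_β` and holomorphic on `S_β × S_β`, which is uniformly Cauchy on
`∂S_β × ∂S_β`, converges uniformly on `S̄_β × S̄_β` to a function continuous and bounded
on `S̄_β × S̄_β` and holomorphic on `S_β × S_β`. -/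
theorem stmt11 (β : ℝ) (hβ : 0 < β) (F : ℕ → ℂ × ℂ → ℂ)
    (hcont : ∀ n, ContinuousOn (F n)
      ({z : ℂ | 0 ≤ z.im ∧ z.im ≤ β} ×ˢ {z : ℂ | 0 ≤ z.im ∧ z.im ≤ β}))
    (hbd : ∀ n, ∃ C : ℝ, ∀ p ∈
      ({z : ℂ | 0 ≤ z.im ∧ z.im ≤ β} ×ˢ {z : ℂ | 0 ≤ z.im ∧ z.im ≤ β}), ‖F n p‖ ≤ C)
    (hdiff : ∀ n, DifferentiableOn ℂ (F n)
      ({z : ℂ | 0 < z.im ∧ z.im < β} ×ˢ {z : ℂ | 0 < z.im ∧ z.im < β}))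
    (hcauchy : UniformCauchySeqOn F atTop
      ({z : ℂ | z.im = 0 ∨ z.im = β} ×ˢ {z : ℂ | z.im = 0 ∨ z.im = β})) :
    ∃ G : ℂ × ℂ → ℂ,
      TendstoUniformlyOn F G atTop
        ({z : ℂ | 0 ≤ z.im ∧ z.im ≤ β} ×ˢ {z : ℂ | 0 ≤ z.im ∧ z.im ≤ β}) ∧
      ContinuousOn G ({z : ℂ | 0 ≤ z.im ∧ z.im ≤ β} ×ˢ {z : ℂ | 0 ≤ z.im ∧ z.im ≤ β}) ∧
      (∃ C : ℝ, ∀ p ∈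
        ({z : ℂ | 0 ≤ z.im ∧ z.im ≤ β} ×ˢ {z : ℂ | 0 ≤ z.im ∧ z.im ≤ β}), ‖G p‖ ≤ C) ∧
      DifferentiableOn ℂ G
        ({z : ℂ | 0 < z.im ∧ z.im < β} ×ˢ {z : ℂ | 0 < z.im ∧ z.im < β}) := by
  have hunif : UniformCauchySeqOn F atTop
      ({z : ℂ | 0 ≤ z.im ∧ z.im ≤ β} ×ˢ {z : ℂ | 0 ≤ z.im ∧ z.im ≤ β}) := by
    rw [Metric.uniformCauchySeqOn_iff] at hcauchy ⊢
    intro ε hε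
    obtain ⟨N, hN⟩ := hcauchy (ε / 2) (half_pos hε)
    refine ⟨N, fun m hm n hn p hp => ?_⟩
    obtain ⟨A, hA⟩ := hbd m
    obtain ⟨B, hB⟩ := hbd n
    rw [dist_eq_norm]
    refine lt_of_le_of_lt ?_ (half_lt_self hε)
    exact norm_le_of_prod_horizontal_strip (f := F m - F n) hβ ((hcont m).sub (hcont n))
      ((hdiff m).sub (hdiff n))
      (fun q hq => (norm_sub_le _ _).trans (add_le_add (hA q hq) (hB q hq)))
      (fun z w hz hw => by
        rw [Pi.sub_apply, ← dist_eq_norm]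
        exact (hN m hm n hn (z, w) ⟨hz, hw⟩).le) hp.1 hp.2
  have hlim : ∀ p ∈ ({z : ℂ | 0 ≤ z.im ∧ z.im ≤ β} ×ˢ {z : ℂ | 0 ≤ z.im ∧ z.im ≤ β}),
      ∃ L, Tendsto (fun n => F n p) atTop (𝓝 L) :=
    fun p hp => cauchySeq_tendsto_of_complete (hunif.cauchySeq hp)
  choose! G hG using hlim
  have hFG := hunif.tendstoUniformlyOn_of_tendsto hG
  refine ⟨G, hFG, hFG.continuousOn (Frequently.of_forall hcont), ?_, ?_⟩
  · obtain ⟨n, hn⟩ := (Metric.tendstoUniformlyOn_iff.1 hFG 1 one_pos).exists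
    obtain ⟨C, hC⟩ := hbd n
    refine ⟨1 + C, fun p hp => ?_⟩
    have h1 := hn p hp
    rw [dist_eq_norm] at h1
    calc ‖G p‖ = ‖(G p - F n p) + F n p‖ := by rw [sub_add_cancel]
      _ ≤ ‖G p - F n p‖ + ‖F n p‖ := norm_add_le _ _
      _ ≤ 1 + C := add_le_add h1.le (hC p hp)
  · have hop : IsOpen {z : ℂ | 0 < z.im ∧ z.im < β} := isOpen_Ioo.preimage continuous_im
    exact (hFG.mono (prod_mono (fun z hz => ⟨hz.1.le, hz.2.le⟩)
      fun z hz => ⟨hz.1.le, hz.2.le⟩)).differentiableOn_of_isOpen (hop.prod hop) hdiff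
end
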